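/- Let A and B be n×n complex positive definite matrices that commute (AB = BA), set C = A^{-1}(A#B), and let D be the (real) Fréchet derivative of the geometric mean map G(A,B) = A#B at (A,B). Then C is Hermitian positive definite, and for all Hermitian matrices X, Y: ‖D(X,Y)‖ ≤ (π/(4·λ_min(C)))·(1 + ‖C‖²)·max(‖X‖, ‖Y‖), where λ_min(C) is the smallest eigenvalue of C. -/

import Mathlib

open Matrix MeasureTheory Real
open scoped Matrix.Norms.L2Operator ComplexOrder

-- the positive semidefinite square root of a positive semidefinite matrix (as in older Mathlib)
noncomputable def Matrix.PosSemidef.sqrt {n 𝕜 : Type*} [Fintype n] [RCLike 𝕜] [DecidableEq n]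
    {A : Matrix n n 𝕜} (hA : A.PosSemidef) : Matrix n n 𝕜 :=
  hA.1.eigenvectorUnitary.1 * diagonal ((↑) ∘ Real.sqrt ∘ hA.1.eigenvalues) *
    (star hA.1.eigenvectorUnitary : Matrix n n 𝕜)

-- `psqrt M` is the unique positive semidefinite square root of a positive semidefinite matrix
open Classical in
noncomputable def psqrt {n : ℕ} (M : Matrix (Fin n) (Fin n) ℂ) : Matrix (Fin n) (Fin n) ℂ :=
  if h : M.PosSemidef then h.sqrt else 0

-- the geometric mean  A#B = A^{1/2} (A^{-1/2} B A^{-1/2})^{1/2} A^{1/2}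
noncomputable def gm {n : ℕ} (A B : Matrix (Fin n) (Fin n) ℂ) : Matrix (Fin n) (Fin n) ℂ :=
  psqrt A * psqrt ((psqrt A)⁻¹ * B * (psqrt A)⁻¹) * psqrt A

-- entrywise complex conjugate
def mconj {n : ℕ} (M : Matrix (Fin n) (Fin n) ℂ) : Matrix (Fin n) (Fin n) ℂ := Mᴴᵀ

-- smallest eigenvalue of a Hermitian matrix
noncomputable def lmin {n : ℕ} {C : Matrix (Fin n) (Fin n) ℂ} (hC : C.IsHermitian) : ℝ :=
  ⨅ i, hC.eigenvalues i

section helpers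

variable {n : ℕ}

lemma spec_form {M : Matrix (Fin n) (Fin n) ℂ} (h : M.IsHermitian) :
    M = h.eigenvectorUnitary.1 * diagonal ((↑) ∘ h.eigenvalues) *
      (star h.eigenvectorUnitary : Matrix (Fin n) (Fin n) ℂ) := by
  have := h.spectral_theorem
  rwa [Unitary.conjStarAlgAut_apply] at this

lemma psqrt_eq {M : Matrix (Fin n) (Fin n) ℂ} (h : M.PosSemidef) : psqrt M = h.sqrt := by
  simp [psqrt, h]

lemma psqrt_psd {M : Matrix (Fin n) (Fin n) ℂ} (h : M.PosSemidef) : (psqrt M).PosSemidef := by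
  rw [psqrt_eq h, Matrix.PosSemidef.sqrt]
  refine PosSemidef.mul_mul_conjTranspose_same (B := h.1.eigenvectorUnitary.1) ?_
  refine PosSemidef.diagonal fun i => ?_
  simp [Real.sqrt_nonneg]

lemma psqrt_sq {M : Matrix (Fin n) (Fin n) ℂ} (h : M.PosSemidef) : psqrt M * psqrt M = M := by
  rw [psqrt_eq h, Matrix.PosSemidef.sqrt]
  conv_rhs => rw [spec_form h.1]
  have hU : (star h.1.eigenvectorUnitary : Matrix (Fin n) (Fin n) ℂ) * h.1.eigenvectorUnitary.1
    = 1 := Unitary.coe_star_mul_self _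
  have hd : diagonal ((fun x : ℝ => (x : ℂ)) ∘ Real.sqrt ∘ h.1.eigenvalues) *
      diagonal ((fun x : ℝ => (x : ℂ)) ∘ Real.sqrt ∘ h.1.eigenvalues) =
      diagonal ((fun x : ℝ => (x : ℂ)) ∘ h.1.eigenvalues) := by
    rw [diagonal_mul_diagonal]
    congr 1
    ext i
    simp only [Function.comp]
    rw [← Complex.ofReal_mul, Real.mul_self_sqrt (h.eigenvalues_nonneg i)]
  generalize h.1.eigenvectorUnitary.1 = U at *
  generalize (star U) = V at *
  calc _ = U * diagonal ((fun x : ℝ => (x : ℂ)) ∘ Real.sqrt ∘ h.1.eigenvalues) * (V * U) *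
        diagonal ((fun x : ℝ => (x : ℂ)) ∘ Real.sqrt ∘ h.1.eigenvalues) * V := by
          simp only [Matrix.mul_assoc]
          try rfl
    _ = U * (diagonal ((fun x : ℝ => (x : ℂ)) ∘ Real.sqrt ∘ h.1.eigenvalues) *
        diagonal ((fun x : ℝ => (x : ℂ)) ∘ Real.sqrt ∘ h.1.eigenvalues)) * V := by
          rw [hU]; simp only [Matrix.mul_assoc, Matrix.one_mul]
    _ = _ := by rw [hd]

lemma psqrt_comm {M N : Matrix (Fin n) (Fin n) ℂ} (h : M.PosSemidef) (hc : M * N = N * M) :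
    psqrt M * N = N * psqrt M := by
  rw [psqrt_eq h, Matrix.PosSemidef.sqrt]
  rw [spec_form h.1] at hc
  have hU : (star h.1.eigenvectorUnitary : Matrix (Fin n) (Fin n) ℂ) * h.1.eigenvectorUnitary.1
    = 1 := Unitary.coe_star_mul_self _
  have hU' : h.1.eigenvectorUnitary.1 * (star h.1.eigenvectorUnitary : Matrix (Fin n) (Fin n) ℂ)
    = 1 := Unitary.coe_mul_star_self _
  set d := h.1.eigenvalues with hdd
  have hnn : ∀ i, 0 ≤ d i := h.eigenvalues_nonneg
  generalize h.1.eigenvectorUnitary.1 = U at *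
  generalize (star U) = V at *
  set E : Matrix (Fin n) (Fin n) ℂ := diagonal ((↑) ∘ d) with hE
  set F : Matrix (Fin n) (Fin n) ℂ := diagonal ((↑) ∘ Real.sqrt ∘ d) with hF
  have h1 : E * (V * N * U) = (V * N * U) * E := by
    calc _ = (V * U) * E * (V * N * U) := by rw [hU, Matrix.one_mul]
      _ = V * (U * E * V * N) * U := by simp only [Matrix.mul_assoc]
      _ = V * (N * (U * E * V)) * U := by rw [hc]
      _ = (V * N * U) * E * (V * U) := by simp only [Matrix.mul_assoc]
      _ = _ := by rw [hU, Matrix.mul_one]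
  have h2 : F * (V * N * U) = (V * N * U) * F := by
    generalize V * N * U = K at *
    ext i j
    have h3 := congrFun (congrFun h1 i) j
    rw [hE, diagonal_mul, mul_diagonal] at h3
    rw [hF, diagonal_mul, mul_diagonal]
    simp only [Function.comp] at *
    by_cases hk : K i j = 0
    · simp [hk]
    · rw [mul_comm] at h3
      have h4 := mul_left_cancel₀ hk h3
      have h5 : d i = d j := by exact_mod_cast h4
      rw [h5, mul_comm]
  change U * F * V * N = N * (U * F * V)
  calc _ = U * F * (V * N) * (U * V) := by rw [hU', Matrix.mul_one]; simp only [Matrix.mul_assoc]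
    _ = U * (F * (V * N * U)) * V := by simp only [Matrix.mul_assoc]
    _ = U * (V * N * U * F) * V := by rw [h2]
    _ = (U * V) * N * (U * F * V) := by simp only [Matrix.mul_assoc]
    _ = _ := by rw [hU', Matrix.one_mul]

lemma psqrt_pd {M : Matrix (Fin n) (Fin n) ℂ} (h : M.PosDef) : (psqrt M).PosDef := by
  have h1 := psqrt_psd h.posSemidef
  have h2 := psqrt_sq h.posSemidef
  rw [h1.1.posDef_iff_eigenvalues_pos]
  have h3 : (psqrt M).det ≠ 0 := by
    intro h0
    have h4 : M.det = 0 := by rw [← h2, det_mul, h0, zero_mul]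
    exact (M.isUnit_iff_isUnit_det.1 h.isUnit).ne_zero h4
  intro i
  refine lt_of_le_of_ne (h1.eigenvalues_nonneg i) fun h0 => h3 ?_
  rw [h1.1.det_eq_prod_eigenvalues]
  exact Finset.prod_eq_zero (Finset.mem_univ i) (by simp [← h0])

lemma conj_pd {S M : Matrix (Fin n) (Fin n) ℂ} (hS : S.PosDef) (hM : M.PosDef) :
    (S * M * S).PosDef := by
  have := (Matrix.IsUnit.posDef_star_right_conjugate_iff (x := M) hS.isUnit).2 hM
  rwa [star_eq_conjTranspose, hS.1.eq] at this

lemma inner_pd {A B : Matrix (Fin n) (Fin n) ℂ} (hA : A.PosDef) (hB : B.PosDef) :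
    ((psqrt A)⁻¹ * B * (psqrt A)⁻¹).PosDef := conj_pd (psqrt_pd hA).inv hB

lemma gm_pd {A B : Matrix (Fin n) (Fin n) ℂ} (hA : A.PosDef) (hB : B.PosDef) :
    (gm A B).PosDef := conj_pd (psqrt_pd hA) (psqrt_pd (inner_pd hA hB))

lemma pd_inv_mul {S : Matrix (Fin n) (Fin n) ℂ} (hS : S.PosDef) : S⁻¹ * S = 1 :=
  nonsing_inv_mul _ (S.isUnit_iff_isUnit_det.1 hS.isUnit)

lemma pd_mul_inv {S : Matrix (Fin n) (Fin n) ℂ} (hS : S.PosDef) : S * S⁻¹ = 1 :=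
  mul_nonsing_inv _ (S.isUnit_iff_isUnit_det.1 hS.isUnit)

lemma inv_gm {A B : Matrix (Fin n) (Fin n) ℂ} (hA : A.PosDef) :
    A⁻¹ * gm A B = (psqrt A)⁻¹ * psqrt ((psqrt A)⁻¹ * B * (psqrt A)⁻¹) * psqrt A := by
  have h1 : A⁻¹ = (psqrt A)⁻¹ * (psqrt A)⁻¹ := by
    rw [← Matrix.mul_inv_rev, psqrt_sq hA.posSemidef]
  rw [h1, gm]
  calc _ = (psqrt A)⁻¹ * ((psqrt A)⁻¹ * psqrt A) * psqrt ((psqrt A)⁻¹ * B * (psqrt A)⁻¹) *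
        psqrt A := by simp only [Matrix.mul_assoc]
    _ = _ := by rw [pd_inv_mul (psqrt_pd hA), Matrix.mul_one]

lemma gm_eq {A B : Matrix (Fin n) (Fin n) ℂ} (hA : A.PosDef) (hB : B.PosDef) :
    gm A B * A⁻¹ * gm A B = B := by
  rw [Matrix.mul_assoc, inv_gm hA, gm]
  have h2 := psqrt_sq (inner_pd hA hB).posSemidef
  have hS := psqrt_pd hA
  have e1 := pd_inv_mul hS
  have e2 := pd_mul_inv hS
  generalize psqrt ((psqrt A)⁻¹ * B * (psqrt A)⁻¹) = R at *
  generalize psqrt A = S at *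
  calc _ = S * R * (S * S⁻¹) * R * S := by simp only [Matrix.mul_assoc]
    _ = S * (R * R) * S := by rw [e2]; simp only [Matrix.mul_assoc, Matrix.one_mul]
    _ = (S * S⁻¹) * B * (S⁻¹ * S) := by rw [h2]; simp only [Matrix.mul_assoc]
    _ = B := by rw [e1, e2]; simp

lemma C_pd {A B : Matrix (Fin n) (Fin n) ℂ} (hA : A.PosDef) (hB : B.PosDef)
    (hAB : A * B = B * A) : (A⁻¹ * gm A B).PosDef := by
  have hS := psqrt_pd hA
  have e1 := pd_inv_mul hS
  have e2 := pd_mul_inv hS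
  have c1 := psqrt_comm hA.posSemidef hAB
  have hR := psqrt_pd (inner_pd hA hB)
  have c2 : ((psqrt A)⁻¹ * B * (psqrt A)⁻¹) * psqrt A =
      psqrt A * ((psqrt A)⁻¹ * B * (psqrt A)⁻¹) := by
    rw [Matrix.mul_assoc, e1, Matrix.mul_one, ← Matrix.mul_assoc, ← Matrix.mul_assoc, e2,
      Matrix.one_mul]
    calc _ = (psqrt A)⁻¹ * B * (psqrt A * (psqrt A)⁻¹) := by rw [e2, Matrix.mul_one]
      _ = (psqrt A)⁻¹ * (B * psqrt A) * (psqrt A)⁻¹ := by simp only [Matrix.mul_assoc]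
      _ = ((psqrt A)⁻¹ * psqrt A) * B * (psqrt A)⁻¹ := by
          rw [← c1]; simp only [Matrix.mul_assoc]
      _ = _ := by rw [e1, Matrix.one_mul]
  have c3 := psqrt_comm (inner_pd hA hB).posSemidef c2
  rw [inv_gm hA, Matrix.mul_assoc, c3, ← Matrix.mul_assoc, e1, Matrix.one_mul]
  exact hR

lemma quad_le (M : Matrix (Fin n) (Fin n) ℂ) (v : EuclideanSpace ℂ (Fin n)) (hv : ‖v‖ = 1) :
    |(star v.ofLp ⬝ᵥ (M *ᵥ v.ofLp)).re| ≤ ‖M‖ := by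
  have h1 : star v.ofLp ⬝ᵥ (M *ᵥ v.ofLp) = inner ℂ v (WithLp.toLp 2 (M *ᵥ v.ofLp)) := by
    rw [EuclideanSpace.inner_eq_star_dotProduct, dotProduct_comm]
  rw [h1]
  refine (Complex.abs_re_le_norm _).trans ((norm_inner_le_norm _ _).trans ?_)
  have := Matrix.l2_opNorm_mulVec M v
  rw [hv] at *
  simpa using this

lemma unit_dot (v : EuclideanSpace ℂ (Fin n)) (hv : ‖v‖ = 1) :
    star v.ofLp ⬝ᵥ v.ofLp = 1 := by
  have : inner ℂ v v = star v.ofLp ⬝ᵥ v.ofLp := by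
    rw [EuclideanSpace.inner_eq_star_dotProduct, dotProduct_comm]
  rw [← this, inner_self_eq_norm_sq_to_K, hv]
  simp

lemma quad_ge {M : Matrix (Fin n) (Fin n) ℂ} (h : M.IsHermitian)
    (v : EuclideanSpace ℂ (Fin n)) (hv : ‖v‖ = 1) :
    lmin h ≤ (star v.ofLp ⬝ᵥ (M *ᵥ v.ofLp)).re := by
  have hpsd : (M - ((lmin h : ℝ) : ℂ) • 1).PosSemidef := by
    have hU' : h.eigenvectorUnitary.1 * (star h.eigenvectorUnitary : Matrix (Fin n) (Fin n) ℂ)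
      = 1 := Unitary.coe_mul_star_self _
    have : M - ((lmin h : ℝ) : ℂ) • 1 = h.eigenvectorUnitary.1 *
        diagonal (fun i => ((h.eigenvalues i - lmin h : ℝ) : ℂ)) *
        (h.eigenvectorUnitary.1)ᴴ := by
      have e : diagonal (fun i => ((h.eigenvalues i - lmin h : ℝ) : ℂ)) =
          diagonal ((↑) ∘ h.eigenvalues) - ((lmin h : ℝ) : ℂ) • 1 := by
        rw [smul_one_eq_diagonal, diagonal_sub]
        congr 1
        ext i
        simp
      rw [e, Matrix.mul_sub, Matrix.sub_mul, Matrix.mul_smul, Matrix.mul_one, Matrix.smul_mul]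
      rw [← star_eq_conjTranspose]
      congr 1
      · exact spec_form h
      · exact congrArg _ hU'.symm
    rw [this]
    refine PosSemidef.mul_mul_conjTranspose_same (PosSemidef.diagonal fun i => ?_) _
    simp only [Pi.zero_apply, Complex.zero_le_real, sub_nonneg]
    exact ciInf_le (Set.finite_range _).bddBelow i
  have h2 := hpsd.dotProduct_mulVec_nonneg v.ofLp
  rw [Matrix.sub_mulVec, dotProduct_sub, Matrix.smul_mulVec, Matrix.one_mulVec, dotProduct_smul,
    unit_dot v hv] at h2
  have h3 := (Complex.le_def.1 h2).1
  simp at h3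
  linarith

lemma lmin_pos (hn : 0 < n) {M : Matrix (Fin n) (Fin n) ℂ} (h : M.PosDef) : 0 < lmin h.1 := by
  have : Nonempty (Fin n) := ⟨⟨0, hn⟩⟩
  obtain ⟨i, hi⟩ := exists_eq_ciInf_of_finite (f := h.1.eigenvalues)
  rw [lmin, ← hi]
  exact h.eigenvalues_pos i

lemma pd_perturb {M N : Matrix (Fin n) (Fin n) ℂ} (h : M.PosDef)
    (hN : N.IsHermitian) (hlt : ‖N‖ < lmin h.1) : (M + N).PosDef := by
  have hh : (M + N).IsHermitian := h.1.add hN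
  rw [hh.posDef_iff_eigenvalues_pos]
  intro i
  rw [hh.eigenvalues_eq, Matrix.add_mulVec, dotProduct_add]
  have hv : ‖hh.eigenvectorBasis i‖ = 1 := hh.eigenvectorBasis.orthonormal.1 i
  have h1 := quad_ge h.1 _ hv
  have h2 := quad_le N _ hv
  have h3 := (abs_le.1 h2).1
  simp only [RCLike.re_to_complex, Complex.add_re]
  linarith

lemma sylv {M C : Matrix (Fin n) (Fin n) ℂ} (hM : M.IsHermitian) (hC : C.IsHermitian)
    (hpos : 0 < lmin hC) : ‖M‖ ≤ ‖M * C + C * M‖ / (2 * lmin hC) := by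
  have e : ‖M‖ = ‖(fun i => ((hM.eigenvalues i : ℝ) : ℂ))‖ := by
    conv_lhs => rw [spec_form hM]
    have := CStarRing.norm_mul_coe_unitary (hM.eigenvectorUnitary.1 * diagonal ((↑) ∘ hM.eigenvalues))
      (star hM.eigenvectorUnitary)
    refine this.trans ?_
    rw [CStarRing.norm_coe_unitary_mul, Matrix.l2_opNorm_diagonal]
    rfl
  rw [e, pi_norm_le_iff_of_nonneg (by positivity)]
  intro i
  rw [le_div_iff₀ (by positivity)]
  have hv : ‖hM.eigenvectorBasis i‖ = 1 := hM.eigenvectorBasis.orthonormal.1 i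
  have h1 := quad_ge hC _ hv
  have h2 := quad_le (M * C + C * M) _ hv
  have h3 := hM.mulVec_eigenvectorBasis i
  set v := (hM.eigenvectorBasis i) with hvd
  set μ := hM.eigenvalues i
  have h4 : star v.ofLp ᵥ* M = (μ : ℝ) • star v.ofLp := by
    have := congrArg star h3
    rw [star_mulVec, hM.eq] at this
    rw [this, star_smul]
    simp
  have h5 : star v.ofLp ⬝ᵥ ((M * C + C * M) *ᵥ v.ofLp) =
      2 * (μ : ℂ) * (star v.ofLp ⬝ᵥ (C *ᵥ v.ofLp)) := by
    rw [Matrix.add_mulVec, dotProduct_add, ← Matrix.mulVec_mulVec, ← Matrix.mulVec_mulVec, h3,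
      Matrix.dotProduct_mulVec _ M, h4, Matrix.mulVec_smul, smul_dotProduct, dotProduct_smul]
    simp only [Complex.real_smul]
    ring
  rw [h5] at h2
  have h6 : (2 * (μ : ℂ) * (star v.ofLp ⬝ᵥ (C *ᵥ v.ofLp))).re =
      2 * μ * (star v.ofLp ⬝ᵥ (C *ᵥ v.ofLp)).re := by
    simp
  rw [h6, abs_mul, abs_mul, abs_two, abs_of_nonneg (hpos.le.trans h1)] at h2
  rw [Complex.norm_real, Real.norm_eq_abs]
  nlinarith [abs_nonneg μ, mul_le_mul_of_nonneg_left h1 (abs_nonneg μ)]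

lemma pd_eventually (hn : 0 < n) {A X : Matrix (Fin n) (Fin n) ℂ} (hA : A.PosDef)
    (hX : X.IsHermitian) : ∀ᶠ t : ℝ in nhds 0, (A + t • X).PosDef := by
  have hc : Filter.Tendsto (fun t : ℝ => ‖t • X‖) (nhds 0) (nhds 0) := by
    have : Continuous (fun t : ℝ => ‖t • X‖) := by fun_prop
    simpa using this.tendsto 0
  filter_upwards [hc.eventually_lt_const (lmin_pos hn hA)] with t ht
  refine pd_perturb hA ?_ ht
  rw [Matrix.IsHermitian, conjTranspose_smul, hX.eq]
  simp

lemma key_limit (hn : 0 < n) {A B X Y L : Matrix (Fin n) (Fin n) ℂ} (hA : A.PosDef) (hB : B.PosDef)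
    (hX : X.IsHermitian) (hY : Y.IsHermitian)
    (hL : HasDerivAt (fun t : ℝ => gm (A + t • X) (B + t • Y)) L 0) :
    L.IsHermitian ∧ L * (A⁻¹ * gm A B) + (gm A B * A⁻¹) * L =
      Y + (gm A B * A⁻¹) * X * (A⁻¹ * gm A B) := by
  have hA' := pd_eventually hn hA hX
  have hB' := pd_eventually hn hB hY
  have hcont := hL.continuousAt.tendsto
  have hs := hasDerivAt_iff_tendsto_slope_zero.1 hL
  simp only [zero_add, zero_smul, add_zero] at hs hcont
  have hcont' := hcont.mono_left (nhdsWithin_le_nhds (s := {0}ᶜ))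
  have hinv : Filter.Tendsto (fun t : ℝ => (A + t • X)⁻¹) (nhdsWithin 0 {0}ᶜ) (nhds A⁻¹) := by
    refine Filter.Tendsto.mono_left ?_ nhdsWithin_le_nhds
    have h1 : ContinuousAt (Ring.inverse : Matrix (Fin n) (Fin n) ℂ → _) A := by
      have := NormedRing.inverse_continuousAt hA.isUnit.unit
      simpa using this
    have h2 : Filter.Tendsto (fun t : ℝ => A + t • X) (nhds 0) (nhds A) := by
      have : Continuous (fun t : ℝ => A + t • X) := by fun_prop
      simpa using this.tendsto 0
    simp only [nonsing_inv_eq_ringInverse]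
    exact h1.tendsto.comp h2
  have hA'' := hA'.filter_mono (nhdsWithin_le_nhds (s := {0}ᶜ))
  have hB'' := hB'.filter_mono (nhdsWithin_le_nhds (s := {0}ᶜ))
  have hne : ∀ᶠ t : ℝ in nhdsWithin 0 {0}ᶜ, t ≠ 0 := eventually_mem_nhdsWithin
  constructor
  · have hcl : IsClosed {M : Matrix (Fin n) (Fin n) ℂ | M.IsHermitian} :=
      isClosed_eq (by fun_prop) continuous_id
    refine hcl.mem_of_tendsto hs ?_
    filter_upwards [hA'', hB''] with t h1 h2
    have := (gm_pd h1 h2).1.sub (gm_pd hA hB).1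
    show Matrix.IsHermitian _
    rw [Matrix.IsHermitian, conjTranspose_smul, this.eq]
    simp
  · have hlim := ((hs.mul (hinv.mul hcont')).sub
      (((hinv.const_mul (gm A B)).mul_const X).mul (hcont'.const_mul A⁻¹))).add
      (hs.const_mul (gm A B * A⁻¹))
    have hev : (fun _ : ℝ => Y) =ᶠ[nhdsWithin 0 {0}ᶜ] (fun x =>
      x⁻¹ • (gm (A + x • X) (B + x • Y) - gm A B) * ((A + x • X)⁻¹ * gm (A + x • X) (B + x • Y)) -
          gm A B * (A + x • X)⁻¹ * X * (A⁻¹ * gm (A + x • X) (B + x • Y)) +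
        gm A B * A⁻¹ * x⁻¹ • (gm (A + x • X) (B + x • Y) - gm A B)) := by
      filter_upwards [hA'', hB'', hne] with t h1 h2 h3
      have g1 := gm_eq h1 h2
      have g0 := gm_eq hA hB
      have i1 : (A + t • X)⁻¹ - A⁻¹ = -(t • ((A + t • X)⁻¹ * X * A⁻¹)) := by
        have a1 := pd_inv_mul h1
        have a2 := pd_mul_inv hA
        calc _ = (A + t • X)⁻¹ * (A * A⁻¹) - ((A + t • X)⁻¹ * (A + t • X)) * A⁻¹ := by
              rw [a1, a2, Matrix.mul_one, Matrix.one_mul]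
          _ = (A + t • X)⁻¹ * (A - (A + t • X)) * A⁻¹ := by noncomm_ring
          _ = _ := by
            rw [sub_add_cancel_left]; simp
      generalize gm (A + t • X) (B + t • Y) = g at *
      generalize gm A B = g₀ at *
      generalize (A + t • X)⁻¹ = P at *
      generalize A⁻¹ = Q at *
      have e : t • Y = (g - g₀) * (P * g) + g₀ * (P - Q) * g + g₀ * Q * (g - g₀) := by
        have : t • Y = (B + t • Y) - B := by abel
        rw [this]
        nth_rewrite 1 [← g1]
        nth_rewrite 1 [← g0]
        noncomm_ring
      rw [i1] at e
      have e2 : Y = t⁻¹ • (t • Y) := by rw [smul_smul, inv_mul_cancel₀ h3, one_smul]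
      rw [e2, e]
      simp only [smul_add, Matrix.mul_neg, Matrix.neg_mul, Matrix.mul_smul, Matrix.smul_mul, smul_neg,
        smul_smul, inv_mul_cancel₀ h3, one_smul, Matrix.mul_assoc]
      abel
    have := tendsto_nhds_unique (hlim.congr' hev.symm) tendsto_const_nhds
    rw [← this]
    noncomm_ring

end helpers

/-- if `A` and `B` commute then `C = A⁻¹(A#B)` is Hermitian positive definite and
`‖D(X,Y)‖ ≤ (π/(4 λ_min(C))) (1 + ‖C‖²) max(‖X‖, ‖Y‖)` for Hermitian `X, Y`. -/
theorem stmt3 {n : ℕ} (hn : 0 < n) (A B : Matrix (Fin n) (Fin n) ℂ)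
    (hA : A.PosDef) (hB : B.PosDef) (hAB : A * B = B * A)
    (C : Matrix (Fin n) (Fin n) ℂ) (hC : C = A⁻¹ * gm A B)
    (D : Matrix (Fin n) (Fin n) ℂ × Matrix (Fin n) (Fin n) ℂ →L[ℝ] Matrix (Fin n) (Fin n) ℂ)
    (hD : HasFDerivWithinAt (fun p : Matrix (Fin n) (Fin n) ℂ × Matrix (Fin n) (Fin n) ℂ =>
        gm p.1 p.2) D
      {p : Matrix (Fin n) (Fin n) ℂ × Matrix (Fin n) (Fin n) ℂ |
        p.1.IsHermitian ∧ p.2.IsHermitian} (A, B)) :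
    ∃ hCpd : C.PosDef,
      ∀ X Y : Matrix (Fin n) (Fin n) ℂ, X.IsHermitian → Y.IsHermitian →
        ‖D (X, Y)‖ ≤ π / (4 * lmin hCpd.1) * (1 + ‖C‖ ^ 2) * max ‖X‖ ‖Y‖ := by
  subst hC
  have hCpd := C_pd hA hB hAB
  refine ⟨hCpd, fun X Y hX hY => ?_⟩
  have hL : HasDerivAt (fun t : ℝ => gm (A + t • X) (B + t • Y)) (D (X, Y)) 0 := by
    have hf : HasDerivAt (fun t : ℝ => ((A + t • X, B + t • Y) :
        Matrix (Fin n) (Fin n) ℂ × Matrix (Fin n) (Fin n) ℂ)) (X, Y) 0 := by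
      refine HasDerivAt.prodMk ?_ ?_
      · simpa using ((hasDerivAt_id (0 : ℝ)).smul_const X).const_add A
      · simpa using ((hasDerivAt_id (0 : ℝ)).smul_const Y).const_add B
    have hmem : ∀ᶠ t : ℝ in nhds 0, ((A + t • X, B + t • Y) :
        Matrix (Fin n) (Fin n) ℂ × Matrix (Fin n) (Fin n) ℂ) ∈
        {p : Matrix (Fin n) (Fin n) ℂ × Matrix (Fin n) (Fin n) ℂ |
          p.1.IsHermitian ∧ p.2.IsHermitian} := by
      refine Filter.Eventually.of_forall fun t => ⟨hA.1.add ?_, hB.1.add ?_⟩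
      · rw [Matrix.IsHermitian, conjTranspose_smul, hX.eq]; simp
      · rw [Matrix.IsHermitian, conjTranspose_smul, hY.eq]; simp
    have h0 : ((A, B) : Matrix (Fin n) (Fin n) ℂ × Matrix (Fin n) (Fin n) ℂ) =
        (A + (0 : ℝ) • X, B + (0 : ℝ) • Y) := by simp
    have := HasFDerivWithinAt.comp_hasDerivAt_of_eq (0 : ℝ) hD hf hmem h0
    exact this
  obtain ⟨hLH, hE⟩ := key_limit hn hA hB hX hY hL
  have hsw : gm A B * A⁻¹ = A⁻¹ * gm A B := by
    have := hCpd.1.eq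
    rwa [conjTranspose_mul, (gm_pd hA hB).1.eq, hA.inv.1.eq] at this
  rw [hsw] at hE
  have hpos := lmin_pos hn hCpd
  have h1 := sylv hLH hCpd.1 hpos
  rw [hE] at h1
  refine h1.trans ?_
  generalize lmin hCpd.1 = c at *
  generalize A⁻¹ * gm A B = C at *
  have h2 : ‖Y + C * X * C‖ ≤ (1 + ‖C‖ ^ 2) * max ‖X‖ ‖Y‖ := by
    calc _ ≤ ‖Y‖ + ‖C‖ * ‖X‖ * ‖C‖ := by
          refine (norm_add_le _ _).trans (add_le_add le_rfl ?_)
          exact (norm_mul_le _ _).trans (mul_le_mul_of_nonneg_right (norm_mul_le _ _) (norm_nonneg _))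
      _ ≤ max ‖X‖ ‖Y‖ + ‖C‖ * max ‖X‖ ‖Y‖ * ‖C‖ := by
          gcongr
          · exact le_max_right _ _
          · exact le_max_left _ _
      _ = _ := by ring
  rw [mul_assoc (π / (4 * c)), div_mul_eq_mul_div, div_le_div_iff₀ (by positivity) (by positivity)]
  have hK : 0 ≤ (1 + ‖C‖ ^ 2) * max ‖X‖ ‖Y‖ := (norm_nonneg _).trans h2
  generalize (1 + ‖C‖ ^ 2) * max ‖X‖ ‖Y‖ = K at *
  have hpi : 2 * K ≤ π * K := mul_le_mul_of_nonneg_right Real.two_le_pi hK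
  nlinarith [mul_le_mul_of_nonneg_right h2 hpos.le, mul_le_mul_of_nonneg_right hpi hpos.le]
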